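/- arXiv:2508.01645 — 14 statements merged into one kernel-verified Lean document; each statement's English description precedes it below -/
import Mathlib

section
/- An MT-algebra M is a T₁-algebra (i.e., the closed elements are join-dense in M) if and only if M satisfies (NT₁): for all a, b ∈ M with a ≰ b there exists an open element u with b ≤ u and a ≰ u. -/
/-- An element `u` is open w.r.t. the interior operator `box` if `box u = u`. -/
def MTOpen {M : Type*} [CompleteBooleanAlgebra M] (box : M → M) (u : M) : Prop :=
  box u = u

/-- The closure operator `◇a = ¬□¬a`. -/
def MTdia {M : Type*} [CompleteBooleanAlgebra M] (box : M → M) (a : M) : M :=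
  (box aᶜ)ᶜ

/-- An element `c` is closed if `◇c = c`. -/
def MTClosed {M : Type*} [CompleteBooleanAlgebra M] (box : M → M) (c : M) : Prop :=
  MTdia box c = c

/-- `box` is an interior operator making the complete Boolean algebra `M` an MT-algebra. -/
def IsMT {M : Type*} [CompleteBooleanAlgebra M] (box : M → M) : Prop :=
  box ⊤ = ⊤ ∧ (∀ a b : M, box (a ⊓ b) = box a ⊓ box b) ∧
    (∀ a : M, box a ≤ a) ∧ (∀ a : M, box a ≤ box (box a))

/-- A subset `S` of a complete lattice is join-dense if every element is a join
of a subset of `S`. -/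
def JoinDense {M : Type*} [CompleteLattice M] (S : Set M) : Prop :=
  ∀ a : M, ∃ T ⊆ S, a = sSup T

/-- An MT-algebra is a `T₁`-algebra (the closed elements are join-dense) iff it
satisfies (NT₁): whenever `a ≰ b` there is an open `u` with `b ≤ u` and `a ≰ u`. -/
theorem t1_iff_nt1 {M : Type*} [CompleteBooleanAlgebra M] (box : M → M)
    (hMT : IsMT box) :
    JoinDense {c : M | MTClosed box c} ↔
      ∀ a b : M, ¬ a ≤ b → ∃ u : M, MTOpen box u ∧ b ≤ u ∧ ¬ a ≤ u := by
  constructor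
  · intro h a b hab
    obtain ⟨T, hT, hb⟩ := h bᶜ
    by_contra! hu
    refine hab (compl_le_compl_iff_le.mp ?_)
    rw [hb]
    refine sSup_le fun c hc => le_compl_comm.mp (hu cᶜ ?_ ?_)
    · exact (compl_eq_comm.mp (hT hc)).symm
    · exact le_compl_comm.mp (hb ▸ le_sSup hc)
  · intro h a
    refine ⟨{c | MTClosed box c ∧ c ≤ a}, fun c hc => hc.1,
      le_antisymm ?_ (sSup_le fun c hc => hc.2)⟩
    by_contra hs
    obtain ⟨u, hu, hau, hsu⟩ := h _ _ (mt compl_le_compl_iff_le.mp hs)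
    have hu_compl : MTClosed box uᶜ := by
      rw [MTClosed, MTdia, compl_compl, hu]
    exact hsu (compl_le_iff_compl_le.mp (le_sSup ⟨hu_compl, compl_le_iff_compl_le.mp hau⟩))
end

section
/- An MT-algebra M satisfies (NT₃½) — for every nonzero a ∈ M and every closed c ∈ M with a ⊓ c = ⊥ there is a family {u_p} of open elements indexed by the dyadic rationals p in [0,1] such that u_p ≺ u_q whenever p < q, a ⊓ u₀ ≠ ⊥, and c ⊓ u₁ = ⊥ — if and only if every open u satisfies u = ⨆{v open : v ≺≺ u}. -/
/-- `a ≺ b` iff `◇a ≤ □b`. -/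
def MTPrec {M : Type*} [CompleteBooleanAlgebra M] (box : M → M) (a b : M) : Prop :=
  MTdia box a ≤ box b

/-- `a ≺≺ b`: there is a family of open elements indexed by the rationals in `[0,1]`
with `a ≤ u 0 ≤ u p ≺ u q ≤ u 1 ≤ b` for all `p < q`. -/
def MTCompletelyBelow {M : Type*} [CompleteBooleanAlgebra M] (box : M → M) (a b : M) : Prop :=
  ∃ u : ℚ → M, (∀ p ∈ Set.Icc (0 : ℚ) 1, MTOpen box (u p)) ∧
    a ≤ u 0 ∧ u 1 ≤ b ∧
    ∀ p ∈ Set.Icc (0 : ℚ) 1, ∀ q ∈ Set.Icc (0 : ℚ) 1,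
      p < q → u p ≤ u q ∧ MTPrec box (u p) (u q)

/-- A dyadic rational: one of the form `m / 2 ^ n`. -/
def IsDyadic (p : ℚ) : Prop := ∃ (m : ℤ) (n : ℕ), p = m / 2 ^ n

theorem exists_isDyadic_btwn {x y : ℚ} (h : x < y) : ∃ d, IsDyadic d ∧ x < d ∧ d < y := by
  obtain ⟨n, hn⟩ := exists_pow_lt_of_lt_one (sub_pos.2 h) (by norm_num : (1 / 2 : ℚ) < 1)
  have h2 : (0 : ℚ) < 2 ^ n := by positivity
  refine ⟨_, ⟨⌊x * 2 ^ n⌋ + 1, n, rfl⟩, ?_, ?_⟩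
  · rw [lt_div_iff₀ h2]
    push_cast
    exact Int.lt_floor_add_one _
  · rw [div_lt_iff₀ h2]
    push_cast
    rw [one_div, inv_pow, inv_lt_iff_one_lt_mul₀ h2] at hn
    have := Int.floor_le (x * 2 ^ n)
    linarith

section MTAlgebra

variable {M : Type*} [CompleteBooleanAlgebra M] {box : M → M}

namespace IsMT

theorem monotone (h : IsMT box) : Monotone box := by
  intro a b hab
  have := h.2.1 a b
  rw [inf_eq_left.2 hab] at this
  exact inf_eq_left.1 this.symm

theorem dia_mono (h : IsMT box) {a b : M} (hab : a ≤ b) : MTdia box a ≤ MTdia box b :=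
  compl_le_compl (h.monotone (compl_le_compl hab))

theorem le_dia (h : IsMT box) (a : M) : a ≤ MTdia box a :=
  le_compl_comm.1 (h.2.2.1 aᶜ)

theorem le_of_prec (h : IsMT box) {a b : M} (hab : MTPrec box a b) : a ≤ b :=
  (h.le_dia a).trans (hab.trans (h.2.2.1 b))

theorem mtOpen_sSup (h : IsMT box) {s : Set M} (hs : ∀ u ∈ s, MTOpen box u) :
    MTOpen box (sSup s) :=
  le_antisymm (h.2.2.1 _)
    (sSup_le fun u hu => (hs u hu).symm.le.trans (h.monotone (le_sSup hu)))

/-- A `≺`-chain of opens indexed by the dyadic rationals in `[0,1]` extends to one indexed by all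
rationals in `[0,1]`, by taking `⨆ {w p | p ≤ r}` at `r`. -/
theorem completelyBelow_of_dyadic (h : IsMT box) {w : ℚ → M}
    (hopen : ∀ p, IsDyadic p → p ∈ Set.Icc (0 : ℚ) 1 → MTOpen box (w p))
    (hprec : ∀ p q, IsDyadic p → IsDyadic q → p ∈ Set.Icc (0 : ℚ) 1 → q ∈ Set.Icc (0 : ℚ) 1 →
      p < q → MTPrec box (w p) (w q)) :
    MTCompletelyBelow box (w 0) (w 1) := by
  have hzero : IsDyadic 0 := ⟨0, 0, by norm_num⟩
  have hone : IsDyadic 1 := ⟨1, 0, by norm_num⟩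
  let S : ℚ → Set M := fun r => w '' {p | IsDyadic p ∧ p ∈ Set.Icc (0 : ℚ) 1 ∧ p ≤ r}
  have hS : ∀ p r, IsDyadic p → p ∈ Set.Icc (0 : ℚ) 1 → p ≤ r → w p ≤ sSup (S r) :=
    fun p r hd hp hpr => le_sSup ⟨p, ⟨hd, hp, hpr⟩, rfl⟩
  refine ⟨fun r => sSup (S r), ?_, hS 0 0 hzero (by norm_num) le_rfl, ?_, ?_⟩
  · rintro r -
    apply h.mtOpen_sSup
    rintro _ ⟨p, ⟨hd, hp, -⟩, rfl⟩
    exact hopen p hd hp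
  · apply sSup_le
    rintro _ ⟨p, ⟨hd, hp, -⟩, rfl⟩
    rcases hp.2.eq_or_lt with rfl | hlt
    · exact le_rfl
    · exact h.le_of_prec (hprec p 1 hd hone hp (by norm_num) hlt)
  · intro r hr q hq hrq
    have key : MTPrec box (sSup (S r)) (sSup (S q)) := by
      obtain ⟨e, hde, hre, heq⟩ := exists_isDyadic_btwn hrq
      obtain ⟨d, hdd, hrd, hdlt⟩ := exists_isDyadic_btwn hre
      have he : e ∈ Set.Icc (0 : ℚ) 1 := ⟨hr.1.trans hre.le, heq.le.trans hq.2⟩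
      have hd : d ∈ Set.Icc (0 : ℚ) 1 := ⟨hr.1.trans hrd.le, hdlt.le.trans he.2⟩
      have hle : sSup (S r) ≤ w d := by
        apply sSup_le
        rintro _ ⟨p, ⟨hdp, hp, hpr⟩, rfl⟩
        exact h.le_of_prec (hprec p d hdp hdd hp hd (hpr.trans_lt hrd))
      exact (h.dia_mono hle).trans
        ((hprec d e hdd hde hd he hdlt).trans (h.monotone (hS e q hde he heq.le)))
    exact ⟨h.le_of_prec key, key⟩

end IsMT

theorem MTCompletelyBelow.le {a b : M} (hab : MTCompletelyBelow box a b) : a ≤ b := by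
  obtain ⟨u, -, h0, h1, hu⟩ := hab
  exact h0.trans ((hu 0 (by norm_num) 1 (by norm_num) one_pos).1.trans h1)

theorem MTCompletelyBelow.mono_right {a b c : M} (hab : MTCompletelyBelow box a b)
    (hbc : b ≤ c) : MTCompletelyBelow box a c := by
  obtain ⟨u, hopen, h0, h1, hu⟩ := hab
  exact ⟨u, hopen, h0, h1.trans hbc, hu⟩

end MTAlgebra

/-- An MT-algebra satisfies (NT₃½) iff every open `u` is the join of the opens
completely below it. -/
theorem nt3half_iff_t3half {M : Type*} [CompleteBooleanAlgebra M] (box : M → M)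
    (hMT : IsMT box) :
    (∀ a c : M, a ≠ ⊥ → MTClosed box c → a ⊓ c = ⊥ →
      ∃ u : ℚ → M,
        (∀ p, IsDyadic p → p ∈ Set.Icc (0 : ℚ) 1 → MTOpen box (u p)) ∧
        (∀ p q, IsDyadic p → IsDyadic q → p ∈ Set.Icc (0 : ℚ) 1 → q ∈ Set.Icc (0 : ℚ) 1 →
          p < q → MTPrec box (u p) (u q)) ∧
        a ⊓ u 0 ≠ ⊥ ∧ c ⊓ u 1 = ⊥) ↔
      ∀ u : M, MTOpen box u →
        u = sSup {v : M | MTOpen box v ∧ MTCompletelyBelow box v u} := by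
  constructor
  · intro hN u hu
    set s := sSup {v : M | MTOpen box v ∧ MTCompletelyBelow box v u}
    refine le_antisymm ?_ (sSup_le fun v hv => hv.2.le)
    by_contra hus
    have ha : u \ s ≠ ⊥ := fun h => hus (sdiff_eq_bot_iff.1 h)
    have hc : MTClosed box uᶜ := by
      rw [MTClosed, MTdia, compl_compl, hu]
    have hac : u \ s ⊓ uᶜ = ⊥ :=
      (disjoint_compl_right.mono_left sdiff_le).eq_bot
    obtain ⟨w, hopen, hprec, hw0, hw1⟩ := hN _ _ ha hc hac
    have hw1u : w 1 ≤ u := by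
      rw [inf_comm, ← disjoint_iff, disjoint_compl_right_iff] at hw1
      exact hw1
    have hw0s : w 0 ≤ s :=
      le_sSup ⟨hopen 0 ⟨0, 0, by norm_num⟩ (by norm_num),
        (hMT.completelyBelow_of_dyadic hopen hprec).mono_right hw1u⟩
    exact hw0 (disjoint_sdiff_self_left.mono_right hw0s).eq_bot
  · intro hT a c ha hc hac
    have hco : MTOpen box cᶜ := compl_injective (by rw [compl_compl]; exact hc)
    have hle : a ≤ cᶜ := (disjoint_iff.2 hac).le_compl_right
    obtain ⟨v, ⟨-, u, hopen, h0, h1, hu⟩, hav⟩ :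
        ∃ v ∈ {v : M | MTOpen box v ∧ MTCompletelyBelow box v cᶜ}, a ⊓ v ≠ ⊥ := by
      by_contra! hbot
      have hdisj : Disjoint a cᶜ := by
        rw [hT _ hco, disjoint_sSup_iff]
        exact fun v hv => disjoint_iff.2 (hbot v hv)
      exact ha (hdisj.eq_bot_of_le hle)
    refine ⟨u, fun p _ hp => hopen p hp, fun p q _ _ hp hq hpq => (hu p hp q hq hpq).2, ?_, ?_⟩
    · exact fun h => hav (le_bot_iff.1 (h ▸ inf_le_inf_left a h0))
    · exact (disjoint_compl_right.mono_right h1).eq_bot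
end

section
/- If M is a T₂-algebra, then M satisfies (NT₂): for all nonzero a, b ∈ M with a ⊓ b = ⊥ there exist open elements u, v with u ⊓ v = ⊥, a ⊓ u ≠ ⊥, and b ⊓ v ≠ ⊥. -/
/-- `a` is a `T₂`-element if `a = ⨅ {◇u : u open, a ≤ u}`. -/
def MTT2Elem {M : Type*} [CompleteBooleanAlgebra M] (box : M → M) (a : M) : Prop :=
  a = sInf (MTdia box '' {u : M | MTOpen box u ∧ a ≤ u})

/-- Every `T₂`-algebra satisfies (NT₂). -/
theorem t2_implies_nt2 {M : Type*} [CompleteBooleanAlgebra M] (box : M → M)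
    (hMT : IsMT box) (hT2 : JoinDense {a : M | MTT2Elem box a}) :
    ∀ a b : M, a ≠ ⊥ → b ≠ ⊥ → a ⊓ b = ⊥ →
      ∃ u v : M, MTOpen box u ∧ MTOpen box v ∧ u ⊓ v = ⊥ ∧ a ⊓ u ≠ ⊥ ∧ b ⊓ v ≠ ⊥ := by
  obtain ⟨-, -, hle, hidem⟩ := hMT
  intro a b ha hb hab
  obtain ⟨T, hT, rfl⟩ := hT2 a
  obtain ⟨t, htT, ht⟩ : ∃ t ∈ T, t ≠ ⊥ := by
    by_contra! h
    exact ha (sSup_eq_bot.mpr h)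
  have hbt : ¬ b ≤ t := fun h =>
    hb (le_bot_iff.mp (hab ▸ le_inf (h.trans (le_sSup htT)) le_rfl))
  have ht2 : t = sInf (MTdia box '' {u : M | MTOpen box u ∧ t ≤ u}) := hT htT
  obtain ⟨u, hu, htu, hbu⟩ : ∃ u, MTOpen box u ∧ t ≤ u ∧ ¬ b ≤ MTdia box u := by
    by_contra! h
    refine hbt (ht2 ▸ le_sInf ?_)
    rintro _ ⟨u, ⟨hu, htu⟩, rfl⟩
    exact h u hu htu
  refine ⟨u, box uᶜ, hu, le_antisymm (hle _) (hidem _), ?_, ?_, ?_⟩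
  · exact le_bot_iff.mp ((inf_le_inf_left u (hle uᶜ)).trans inf_compl_eq_bot.le)
  · exact fun h => ht (le_bot_iff.mp (h ▸ le_inf (le_sSup htT) htu))
  · exact fun h => hbu (le_compl_iff_disjoint_right.mpr (disjoint_iff.mpr h))
end

section
/- If an MT-algebra M satisfies (NT₂), then the frame of open elements of M is Hausdorff: every open a with a ≠ ⊤ satisfies a = ⨆{u open : u ≤ a and □¬u ≰ a}. -/
/-- If an MT-algebra satisfies (NT₂), then its frame of opens is Hausdorff:
every open `a ≠ ⊤` is the join of the opens `u ≤ a` whose pseudocomplement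
`□¬u` is not below `a`. -/
theorem nt2_implies_hausdorff_frame {M : Type*} [CompleteBooleanAlgebra M] (box : M → M)
    (hMT : IsMT box)
    (hNT2 : ∀ a b : M, a ≠ ⊥ → b ≠ ⊥ → a ⊓ b = ⊥ →
      ∃ u v : M, MTOpen box u ∧ MTOpen box v ∧ u ⊓ v = ⊥ ∧ a ⊓ u ≠ ⊥ ∧ b ⊓ v ≠ ⊥) :
    ∀ a : M, MTOpen box a → a ≠ ⊤ →
      a = sSup {u : M | MTOpen box u ∧ u ≤ a ∧ ¬ box uᶜ ≤ a} := by
  obtain ⟨-, hinf, -, -⟩ := hMT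
  have hmono : Monotone box := fun x y hxy => by
    rw [← inf_eq_left, ← hinf, inf_eq_left.mpr hxy]
  intro a ha hatop
  refine le_antisymm ?_ (sSup_le fun u hu => hu.2.1)
  set s := sSup {u : M | MTOpen box u ∧ u ≤ a ∧ ¬ box uᶜ ≤ a}
  by_contra hle
  have hdiff : a ⊓ sᶜ ≠ ⊥ := fun h => hle (disjoint_compl_right_iff.mp (disjoint_iff.mpr h))
  have hcompl : aᶜ ≠ ⊥ := fun h => hatop (compl_eq_bot.mp h)
  obtain ⟨u, v, hu, hv, huv, hau, hav⟩ := hNT2 (a ⊓ sᶜ) aᶜ hdiff hcompl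
    (disjoint_iff.mp (disjoint_compl_right.mono_left inf_le_left))
  have hopen : MTOpen box (a ⊓ u) := by
    unfold MTOpen at *
    rw [hinf, ha, hu]
  have hv_le : v ≤ box (a ⊓ u)ᶜ := by
    rw [← show box v = v from hv]
    refine hmono (le_compl_iff_disjoint_right.mpr ?_)
    exact (disjoint_iff.mpr huv).symm.mono_right inf_le_right
  have hnot : ¬ box (a ⊓ u)ᶜ ≤ a := fun h =>
    hav (disjoint_iff.mp (disjoint_compl_left.mono_right (hv_le.trans h)))
  have hle_s : a ⊓ u ≤ s := le_sSup ⟨hopen, inf_le_left, hnot⟩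
  apply hau
  rw [inf_right_comm]
  exact disjoint_iff.mp (disjoint_compl_right.mono_left hle_s)
end

section
/- If M is a T₁-algebra and the frame of open elements of M is Hausdorff (i.e., every open a ≠ ⊤ satisfies a = ⨆{u open : u ≤ a and □¬u ≰ a}), then M satisfies (NT₂): for all nonzero a, b ∈ M with a ⊓ b = ⊥ there exist open elements u, v with u ⊓ v = ⊥, a ⊓ u ≠ ⊥, and b ⊓ v ≠ ⊥. -/
/-- If `M` is a `T₁`-algebra whose frame of opens is Hausdorff, then `M`
satisfies (NT₂). -/
theorem t1_hausdorff_implies_nt2 {M : Type*} [CompleteBooleanAlgebra M] (box : M → M)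
    (hMT : IsMT box)
    (hT1 : JoinDense {c : M | MTClosed box c})
    (hHaus : ∀ a : M, MTOpen box a → a ≠ ⊤ →
      a = sSup {u : M | MTOpen box u ∧ u ≤ a ∧ ¬ box uᶜ ≤ a}) :
    ∀ a b : M, a ≠ ⊥ → b ≠ ⊥ → a ⊓ b = ⊥ →
      ∃ u v : M, MTOpen box u ∧ MTOpen box v ∧ u ⊓ v = ⊥ ∧ a ⊓ u ≠ ⊥ ∧ b ⊓ v ≠ ⊥ := by
  intro a b ha hb hab
  obtain ⟨-, -, box_le, box_le_box_box⟩ := hMT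
  obtain ⟨c, hc, hcb, hc0⟩ : ∃ c, MTClosed box c ∧ c ≤ b ∧ c ≠ ⊥ := by
    obtain ⟨T, hT, rfl⟩ := hT1 b
    by_contra! h
    exact hb (sSup_eq_bot.2 fun c hcT => h c (hT hcT) (le_sSup hcT))
  have hc_open : MTOpen box cᶜ := by
    have h := congrArg compl hc
    rwa [MTdia, compl_compl] at h
  have hac : a ≤ cᶜ :=
    (disjoint_iff.2 hab).le_compl_right.trans (compl_le_compl hcb)
  have hsup := hHaus cᶜ hc_open (mt compl_eq_top.1 hc0)
  obtain ⟨u, ⟨hu, -, huc⟩, hau⟩ :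
      ∃ u ∈ {u : M | MTOpen box u ∧ u ≤ cᶜ ∧ ¬ box uᶜ ≤ cᶜ}, a ⊓ u ≠ ⊥ := by
    by_contra! h
    have hdisj : Disjoint a cᶜ := by
      rw [hsup]
      exact disjoint_sSup_iff.2 fun u hu => disjoint_iff.2 (h u hu)
    exact ha (hdisj.eq_bot_of_le hac)
  refine ⟨u, box uᶜ, hu, le_antisymm (box_le _) (box_le_box_box _), ?_, hau, fun h => huc ?_⟩
  · exact (disjoint_compl_right.mono_right (box_le _)).eq_bot
  · exact ((disjoint_iff.2 h).mono_left hcb).le_compl_left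
end

section
/- An MT-algebra M is N-locally compact if and only if ⊤ = ⨆{u open : u ◁ ⊤}, i.e., ⊤ is the join of those open elements that lie below some compact element. -/
/-- `k` is compact: every open cover of `k` has a finite subcover. -/
def MTCompactElem {M : Type*} [CompleteBooleanAlgebra M] (box : M → M) (k : M) : Prop :=
  ∀ U : Set M, (∀ u ∈ U, MTOpen box u) → k ≤ sSup U →
    ∃ V ⊆ U, V.Finite ∧ k ≤ sSup V

/-- `a ◁ b` iff there is a compact `k` with `a ≤ k ≤ b`. -/
def MTWayInside {M : Type*} [CompleteBooleanAlgebra M] (box : M → M) (a b : M) : Prop :=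
  ∃ k : M, MTCompactElem box k ∧ a ≤ k ∧ k ≤ b

/-- `M` is N-locally compact if every nonzero `a` meets the interior of some
compact element. -/
def MTNLocallyCompact {M : Type*} [CompleteBooleanAlgebra M] (box : M → M) : Prop :=
  ∀ a : M, a ≠ ⊥ → ∃ k : M, MTCompactElem box k ∧ a ⊓ box k ≠ ⊥

/-- `M` is locally compact if every open is the join of the opens way inside it. -/
def MTLocallyCompact {M : Type*} [CompleteBooleanAlgebra M] (box : M → M) : Prop :=
  ∀ u : M, MTOpen box u → u = sSup {v : M | MTOpen box v ∧ MTWayInside box v u}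

/-- An MT-algebra is N-locally compact iff `⊤` is the join of the opens lying
below some compact element. -/
theorem nlc_iff_top_join {M : Type*} [CompleteBooleanAlgebra M] (box : M → M)
    (hMT : IsMT box) :
    MTNLocallyCompact box ↔
      (⊤ : M) = sSup {u : M | MTOpen box u ∧ MTWayInside box u ⊤} := by
  obtain ⟨-, hinf, hle, hidem⟩ := hMT
  constructor
  · intro h
    set s := sSup {u : M | MTOpen box u ∧ MTWayInside box u ⊤}
    by_contra hne
    obtain ⟨k, hk, hmeet⟩ := h sᶜ fun hs => hne (compl_eq_bot.mp hs).symm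
    have hks : box k ≤ s :=
      le_sSup ⟨(hle _).antisymm (hidem k), k, hk, hle k, le_top⟩
    exact hmeet (disjoint_compl_left.mono_right hks).eq_bot
  · intro h a ha
    by_contra! hmeet
    refine ha ?_
    rw [← inf_top_eq a, h, inf_sSup_eq]
    simp only [iSup_eq_bot]
    rintro u ⟨hu, k, hk, huk, -⟩
    have hmono : u ≤ box k := by
      rw [← inf_eq_left, ← hu, ← hinf, inf_eq_left.mpr huk]
    exact le_bot_iff.mp ((inf_le_inf_left a hmono).trans (hmeet k hk).le)
end

section
/- If an MT-algebra M is locally compact, then M is N-locally compact; and if M is compact, then M is N-locally compact. -/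
/-- Local compactness implies N-local compactness, and compactness implies
N-local compactness. -/
theorem lc_and_compact_imply_nlc {M : Type*} [CompleteBooleanAlgebra M] (box : M → M)
    (hMT : IsMT box) :
    (MTLocallyCompact box → MTNLocallyCompact box) ∧
      (MTCompactElem box ⊤ → MTNLocallyCompact box) := by
  obtain ⟨htop, hinf, -⟩ := hMT
  refine ⟨fun h a ha => ?_, fun h a ha => ⟨⊤, h, by rwa [htop, inf_top_eq]⟩⟩
  by_contra! hdisj
  have hmono : Monotone box := fun x y hxy => by
    rw [← inf_eq_left, ← hinf, inf_eq_left.mpr hxy]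
  have hbot : a ⊓ sSup {v : M | MTOpen box v ∧ MTWayInside box v ⊤} = ⊥ := by
    rw [inf_sSup_eq, iSup₂_eq_bot]
    rintro v ⟨hv, k, hk, hvk, -⟩
    have hvbox : v ≤ box k := hv.symm.le.trans (hmono hvk)
    exact le_bot_iff.mp ((inf_le_inf_left a hvbox).trans (hdisj k hk).le)
  rw [← h ⊤ htop, inf_top_eq] at hbot
  exact ha hbot
end

section
/- Every N-locally compact T₂-algebra is locally compact: if M is an MT-algebra such that the T₂-elements are join-dense and for every a ≠ ⊥ there is a compact k with a ⊓ □k ≠ ⊥, then every open u satisfies u = ⨆{v open : v ◁ u}. -/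
theorem IsMT.monotone_s7 {M : Type*} [CompleteBooleanAlgebra M] {box : M → M}
    (hMT : IsMT box) : Monotone box := by
  intro a b hab
  have h := hMT.2.1 a b
  rw [inf_eq_left.mpr hab] at h
  exact inf_eq_left.mp h.symm

theorem IsMT.open_box {M : Type*} [CompleteBooleanAlgebra M] {box : M → M}
    (hMT : IsMT box) (a : M) : MTOpen box (box a) :=
  le_antisymm (hMT.2.2.1 _) (hMT.2.2.2 _)

theorem IsMT.open_sSup {M : Type*} [CompleteBooleanAlgebra M] {box : M → M}
    (hMT : IsMT box) {U : Set M} (hU : ∀ u ∈ U, MTOpen box u) : MTOpen box (sSup U) := by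
  refine le_antisymm (hMT.2.2.1 _) (sSup_le fun u hu => ?_)
  rw [← hU u hu]
  exact hMT.monotone_s7 (le_sSup hu)

/-- The interior of a finite meet of complements dominates any common lower bound of the
interiors of these complements. -/
theorem IsMT.le_box_compl_sSup {M : Type*} [CompleteBooleanAlgebra M] {box : M → M}
    (hMT : IsMT box) {a : M} {V : Set M} (hV : V.Finite) (h : ∀ x ∈ V, a ≤ box xᶜ) :
    a ≤ box (sSup V)ᶜ := by
  induction V, hV using Set.Finite.induction_on with
  | empty => simp [hMT.1]
  | insert _ _ ih =>
    rw [sSup_insert, compl_sup, hMT.2.1]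
    exact le_inf (h _ (Set.mem_insert _ _)) (ih fun x hx => h x (Set.mem_insert_of_mem _ hx))

/-- The meet of a compact element with the complement of an open element is compact. -/
theorem MTCompactElem.inf_compl {M : Type*} [CompleteBooleanAlgebra M] {box : M → M} {k o : M}
    (hk : MTCompactElem box k) (ho : MTOpen box o) : MTCompactElem box (k ⊓ oᶜ) := by
  intro U hU hkU
  obtain ⟨V, hVU, hVfin, hkV⟩ := hk (insert o U)
    (by rintro u (rfl | hu); exacts [ho, hU u hu])
    (by rwa [sSup_insert, ← sdiff_le_iff, sdiff_eq])
  refine ⟨V \ {o}, fun x hx => (hVU hx.1).resolve_left hx.2, hVfin.sdiff, ?_⟩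
  rw [← sdiff_eq, sdiff_le_iff, ← sSup_insert]
  exact hkV.trans (sSup_le_sSup (by simp))

/-- In a complete lattice, a join-dense set has a nonzero member below each nonzero element. -/
theorem JoinDense.exists_ne_bot_le {M : Type*} [CompleteLattice M] {S : Set M}
    (hS : JoinDense S) {b : M} (hb : b ≠ ⊥) : ∃ a ∈ S, a ≠ ⊥ ∧ a ≤ b := by
  obtain ⟨T, hTS, rfl⟩ := hS b
  by_contra! h
  exact hb (sSup_eq_bot.mpr fun a ha => by_contra fun hne => h a (hTS ha) hne (le_sSup ha))

/-- A `T₂`-element below both an open `u` and the interior of a compact element lies below an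
open element way inside `u`. -/
theorem MTT2Elem.exists_open_wayInside {M : Type*} [CompleteBooleanAlgebra M] {box : M → M}
    (hMT : IsMT box) {a k u : M} (ha : MTT2Elem box a) (hk : MTCompactElem box k)
    (hu : MTOpen box u) (hau : a ≤ u) (hak : a ≤ box k) :
    ∃ v, MTOpen box v ∧ MTWayInside box v u ∧ a ≤ v := by
  let U : Set M := (fun v => box vᶜ) '' {v | MTOpen box v ∧ a ≤ v}
  have hU : ∀ x ∈ U, MTOpen box x := by
    rintro _ ⟨v, -, rfl⟩
    exact hMT.open_box _
  have haU : (sSup U)ᶜ ≤ a := by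
    rw [ha]
    refine le_sInf ?_
    rintro _ ⟨v, hv, rfl⟩
    exact compl_le_compl (le_sSup ⟨v, hv, rfl⟩)
  obtain ⟨V, hVU, hVfin, hkV⟩ := hk.inf_compl hu U hU
    (inf_le_right.trans (compl_le_of_compl_le (haU.trans hau)))
  refine ⟨box (k ⊓ (sSup V)ᶜ), hMT.open_box _, ⟨k ⊓ (sSup V)ᶜ,
    hk.inf_compl (hMT.open_sSup fun x hx => hU x (hVU hx)), hMT.2.2.1 _, ?_⟩, ?_⟩
  · rw [← sdiff_eq, sdiff_le_iff] at hkV ⊢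
    rwa [sup_comm]
  · rw [hMT.2.1]
    refine le_inf hak (hMT.le_box_compl_sSup hVfin fun x hx => ?_)
    obtain ⟨v, ⟨hv, hav⟩, rfl⟩ := hVU hx
    refine hav.trans ?_
    conv_lhs => rw [← hv]
    exact hMT.monotone_s7 (le_compl_comm.mp (hMT.2.2.1 _))

/-- Every N-locally compact `T₂`-algebra is locally compact. -/
theorem nlc_t2_implies_lc {M : Type*} [CompleteBooleanAlgebra M] (box : M → M)
    (hMT : IsMT box)
    (hT2 : JoinDense {a : M | MTT2Elem box a})
    (hNLC : MTNLocallyCompact box) :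
    MTLocallyCompact box := by
  intro u hu
  refine le_antisymm ?_ (sSup_le fun v ⟨_, _, _, hvk, hku⟩ => hvk.trans hku)
  set s := sSup {v : M | MTOpen box v ∧ MTWayInside box v u}
  by_contra hus
  have hne : u ⊓ sᶜ ≠ ⊥ := by rwa [← sdiff_eq, Ne, sdiff_eq_bot_iff]
  obtain ⟨k, hk, hkne⟩ := hNLC _ hne
  obtain ⟨a, ha, hane, hale⟩ := hT2.exists_ne_bot_le hkne
  obtain ⟨⟨hau, has⟩, hak⟩ : (a ≤ u ∧ a ≤ sᶜ) ∧ a ≤ box k := by simpa using hale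
  obtain ⟨v, hv, hvu, hav⟩ := MTT2Elem.exists_open_wayInside hMT ha hk hu hau hak
  have hs : a ≤ s := hav.trans (le_sSup ⟨hv, hvu⟩)
  exact hane (le_bot_iff.mp ((le_inf hs has).trans inf_compl_eq_bot.le))
end

section
/- Isbell's Spatiality Theorem: every compact subfit frame is spatial, i.e., if L is a compact subfit frame and a, b ∈ L with a ≰ b, then there is a completely prime filter of L containing a but not b. -/
/-- A filter of a frame: a nonempty, upward-closed subset closed under binary meets. -/
def FrameFilter {L : Type*} [Order.Frame L] (F : Set L) : Prop :=
  F.Nonempty ∧ (∀ a b : L, a ∈ F → a ≤ b → b ∈ F) ∧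
    ∀ a b : L, a ∈ F → b ∈ F → a ⊓ b ∈ F

/-- A filter is completely prime if it contains a member of every family whose
join it contains. -/
def CompletelyPrimeFilter {L : Type*} [Order.Frame L] (F : Set L) : Prop :=
  FrameFilter F ∧ ∀ S : Set L, sSup S ∈ F → ∃ s ∈ S, s ∈ F

/-- In a distributive lattice with top, every coatom is meet-prime. -/
theorem IsCoatom.infPrime_of_distrib {α : Type*} [DistribLattice α] [OrderTop α] {m : α}
    (hm : IsCoatom m) : InfPrime m := by
  refine ⟨fun h => hm.1 h.eq_top, fun {x y} hxy => ?_⟩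
  by_contra! h
  have hx : m ⊔ x = ⊤ := hm.2 _ (left_lt_sup.2 h.1)
  have hy : m ⊔ y = ⊤ := hm.2 _ (left_lt_sup.2 h.2)
  apply hm.1
  rw [← sup_eq_left.2 hxy, sup_inf_left, hx, hy, inf_top_eq]

/-- The elements not below a meet-prime element form a completely prime filter. -/
theorem InfPrime.completelyPrimeFilter {L : Type*} [Order.Frame L] {m : L} (hm : InfPrime m) :
    CompletelyPrimeFilter {x : L | ¬ x ≤ m} := by
  refine ⟨⟨⟨⊤, fun h => hm.ne_top (top_le_iff.1 h)⟩, fun x y hx hxy hy => hx (hxy.trans hy),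
    fun x y hx hy hxy => (hm.2 hxy).elim hx hy⟩, fun S hS => ?_⟩
  by_contra! h
  exact hS (sSup_le fun s hs => not_not.1 (h s hs))

/-- A complete lattice in which every cover of the top has a finite subcover is coatomic. -/
theorem isCoatomic_of_finite_subcover {α : Type*} [CompleteLattice α]
    (hcomp : ∀ S : Set α, sSup S = ⊤ → ∃ F ⊆ S, F.Finite ∧ sSup F = ⊤) : IsCoatomic α := by
  apply CompleteLattice.coatomic_of_top_compact
  rw [CompleteLattice.isCompactElement_iff_exists_le_sSup_of_le_sSup]
  intro S hS
  obtain ⟨F, hFS, hF, hF'⟩ := hcomp S (top_le_iff.1 hS)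
  refine ⟨hF.toFinset, by simpa using hFS, ?_⟩
  rw [Finset.sup_id_eq_sSup, hF.coe_toFinset, hF']

/-- Isbell's Spatiality Theorem: every compact subfit frame is spatial, i.e.,
whenever `a ≰ b` there is a completely prime filter containing `a` but not `b`. -/
theorem isbell_spatiality {L : Type*} [Order.Frame L]
    (hcomp : ∀ S : Set L, sSup S = ⊤ → ∃ F ⊆ S, F.Finite ∧ sSup F = ⊤)
    (hsubfit : ∀ a b : L, ¬ a ≤ b → ∃ c : L, a ⊔ c = ⊤ ∧ b ⊔ c ≠ ⊤) :
    ∀ a b : L, ¬ a ≤ b →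
      ∃ P : Set L, CompletelyPrimeFilter P ∧ a ∈ P ∧ b ∉ P := by
  intro a b hab
  obtain ⟨c, hac, hbc⟩ := hsubfit a b hab
  have := isCoatomic_of_finite_subcover hcomp
  obtain ⟨m, hm, hbcm⟩ := (eq_top_or_exists_le_coatom (b ⊔ c)).resolve_left hbc
  refine ⟨{x | ¬ x ≤ m}, hm.infPrime_of_distrib.completelyPrimeFilter, fun ham => hm.1 ?_,
    not_not.2 (le_sup_left.trans hbcm)⟩
  exact top_le_iff.1 (hac ▸ sup_le ham (le_sup_right.trans hbcm))
end

section
/- If M is a T₀-algebra and c is a minimal element of the set of nonzero closed elements of M (c is closed, c ≠ ⊥, and every closed d with ⊥ ≠ d ≤ c satisfies d = c), then c is an atom of M. -/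
/-- `s` is saturated if it is a meet of a set of open elements. -/
def MTSaturated {M : Type*} [CompleteBooleanAlgebra M] (box : M → M) (s : M) : Prop :=
  ∃ U : Set M, (∀ u ∈ U, MTOpen box u) ∧ s = sInf U

/-- `a` is a `T₀`-element if it is the meet of a saturated and a closed element. -/
def MTT0Elem {M : Type*} [CompleteBooleanAlgebra M] (box : M → M) (a : M) : Prop :=
  ∃ s c : M, MTSaturated box s ∧ MTClosed box c ∧ a = s ⊓ c

theorem MTClosed.inf {M : Type*} [CompleteBooleanAlgebra M] {box : M → M} (hMT : IsMT box)
    {c d : M} (hc : MTClosed box c) (hd : MTClosed box d) : MTClosed box (c ⊓ d) := by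
  obtain ⟨-, hinf, hle, -⟩ := hMT
  have hmono : Monotone box := fun a b hab => by
    rw [← inf_eq_left.mpr hab, hinf]
    exact inf_le_right
  have hdia : Monotone (MTdia box) := fun a b hab =>
    compl_le_compl (hmono (compl_le_compl hab))
  refine le_antisymm (le_inf ?_ ?_) (le_compl_comm.mp (hle _))
  · exact (hdia inf_le_left).trans_eq hc
  · exact (hdia inf_le_right).trans_eq hd

theorem MTOpen.closed_compl {M : Type*} [CompleteBooleanAlgebra M] {box : M → M} {u : M}
    (hu : MTOpen box u) : MTClosed box uᶜ := by
  unfold MTClosed MTdia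
  rw [compl_compl, hu]

/-- A minimal nonzero closed element lies below every nonzero `T₀`-element under it. -/
theorem MTT0Elem.le_of_minimal_closed {M : Type*} [CompleteBooleanAlgebra M] {box : M → M}
    (hMT : IsMT box) {a c : M} (hc : MTClosed box c)
    (hmin : ∀ d : M, MTClosed box d → d ≠ ⊥ → d ≤ c → d = c)
    (ha : MTT0Elem box a) (hane : a ≠ ⊥) (hac : a ≤ c) : c ≤ a := by
  obtain ⟨s, d, ⟨U, hU, rfl⟩, hd, rfl⟩ := ha
  refine le_inf (le_sInf fun u hu => ?_) ?_
  · by_contra hcu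
    have hcompl : c ⊓ uᶜ = c := by
      refine hmin _ (hc.inf hMT (hU u hu).closed_compl) (fun h => hcu ?_) inf_le_left
      exact disjoint_compl_right_iff.mp (disjoint_iff.mpr h)
    have hdisj : Disjoint c u := le_compl_iff_disjoint_right.mp (inf_eq_left.mp hcompl)
    exact hane (le_bot_iff.mp (hdisj hac (inf_le_left.trans (sInf_le hu))))
  · exact inf_eq_left.mp (hmin _ (hc.inf hMT hd)
      (fun h => hane (le_bot_iff.mp (h ▸ le_inf hac inf_le_right))) inf_le_left)

/-- In a `T₀`-algebra, every minimal nonzero closed element is an atom. -/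
theorem minimal_closed_is_atom {M : Type*} [CompleteBooleanAlgebra M] (box : M → M)
    (hMT : IsMT box) (hT0 : JoinDense {a : M | MTT0Elem box a}) (c : M)
    (hc : MTClosed box c) (hne : c ≠ ⊥)
    (hmin : ∀ d : M, MTClosed box d → d ≠ ⊥ → d ≤ c → d = c) :
    IsAtom c := by
  refine ⟨hne, fun b hb => ?_⟩
  by_contra hbne
  obtain ⟨T, hT, rfl⟩ := hT0 b
  obtain ⟨a, haT, hane⟩ : ∃ a ∈ T, a ≠ ⊥ := by
    simpa [sSup_eq_bot] using hbne
  have hle := le_sSup haT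
  exact hb.not_ge
    (((hT haT).le_of_minimal_closed hMT hc hmin hane (hle.trans hb.le)).trans hle)
end

section
/- Every nontrivial compact T₀-algebra contains a closed atom: if M is a T₀-algebra with ⊥ ≠ ⊤ whose top element is compact, then there is an atom x of M with ◇x = x. -/
section InteriorOperator

variable {M : Type*} [CompleteBooleanAlgebra M] {box : M → M}

lemma IsMT.monotone_s11 (h : IsMT box) : Monotone box := fun a b hab => by
  rw [← inf_eq_left, ← h.2.1, inf_eq_left.2 hab]

lemma IsMT.mtOpen_of_le (h : IsMT box) {u : M} (hu : u ≤ box u) : MTOpen box u :=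
  le_antisymm (h.2.2.1 u) hu

lemma MTOpen.sSup (h : IsMT box) {U : Set M} (hU : ∀ u ∈ U, MTOpen box u) :
    MTOpen box (sSup U) :=
  h.mtOpen_of_le <| sSup_le fun u hu =>
    (hU u hu).symm.le.trans (h.monotone_s11 (le_sSup hu))

lemma MTOpen.sup (h : IsMT box) {u v : M} (hu : MTOpen box u) (hv : MTOpen box v) :
    MTOpen box (u ⊔ v) :=
  h.mtOpen_of_le <| sup_le (hu.symm.le.trans (h.monotone_s11 le_sup_left))
    (hv.symm.le.trans (h.monotone_s11 le_sup_right))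

lemma mtClosed_iff_mtOpen_compl {c : M} : MTClosed box c ↔ MTOpen box cᶜ := by
  rw [MTClosed, MTdia, MTOpen, compl_eq_comm, eq_comm]

/-- A compact nontrivial MT-algebra has a maximal proper open element. -/
lemma MTCompactElem.exists_maximal_open (h : IsMT box) (hnt : (⊥ : M) ≠ ⊤)
    (hcomp : MTCompactElem box ⊤) : ∃ u : M, Maximal (fun u => MTOpen box u ∧ u ≠ ⊤) u := by
  have hbot : MTOpen box (⊥ : M) := h.mtOpen_of_le bot_le
  obtain ⟨u, -, hu⟩ := zorn_le_nonempty₀ {u : M | MTOpen box u ∧ u ≠ ⊤} (fun C hC hchain y hy => by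
    refine ⟨sSup C, ⟨MTOpen.sSup h fun u hu => (hC hu).1, fun htop => ?_⟩,
      fun z hz => le_sSup hz⟩
    obtain ⟨V, hVC, hVfin, hV⟩ := hcomp C (fun u hu => (hC hu).1) htop.ge
    obtain ⟨w, hw, hle⟩ : ∃ w ∈ C, ∀ v ∈ V, v ≤ w := by
      clear hV
      induction V, hVfin using Set.Finite.induction_on with
      | empty => exact ⟨y, hy, by simp⟩
      | @insert a V _ _ ih =>
        obtain ⟨haC, hVC⟩ := Set.insert_subset_iff.1 hVC
        obtain ⟨w, hw, hle⟩ := ih hVC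
        obtain ⟨z, hz, haz, hwz⟩ := hchain.directedOn a haC w hw
        exact ⟨z, hz, Set.forall_mem_insert.2 ⟨haz, fun v hv => (hle v hv).trans hwz⟩⟩
    exact (hC hw).2 (top_le_iff.1 (hV.trans (sSup_le hle)))) ⊥ ⟨hbot, hnt⟩
  exact ⟨u, hu⟩

/-- In a `T₀`-algebra, the complement of a maximal proper open element is an atom. -/
lemma isAtom_compl_of_maximal_open (h : IsMT box) (hT0 : JoinDense {a : M | MTT0Elem box a})
    {u : M} (hu : Maximal (fun u => MTOpen box u ∧ u ≠ ⊤) u) : IsAtom uᶜ := by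
  have key : ∀ v : M, MTOpen box v → v ≤ u ∨ uᶜ ≤ v := fun v hv => by
    by_cases hsup : u ⊔ v = ⊤
    · exact Or.inr (codisjoint_iff_compl_le_right.1 (codisjoint_iff.2 hsup))
    · exact Or.inl (le_sup_right.trans (hu.le_of_ge ⟨hu.prop.1.sup h hv, hsup⟩ le_sup_left))
  refine ⟨fun hbot => hu.prop.2 (compl_eq_bot.1 hbot), fun a ha => ?_⟩
  obtain ⟨T, hT, rfl⟩ := hT0 a
  refine sSup_eq_bot.2 fun t ht => by_contra fun hne => ha.not_ge ?_
  have htu : t ≤ uᶜ := (le_sSup ht).trans ha.le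
  obtain ⟨s, c, ⟨U, hU, rfl⟩, hc, rfl⟩ := hT ht
  refine le_trans (le_inf (le_sInf fun v hv => ?_) ?_) (le_sSup ht)
  · refine (key v (hU v hv)).resolve_left fun hvu => hne ?_
    exact le_bot_iff.1 (disjoint_compl_right (inf_le_left.trans ((sInf_le hv).trans hvu)) htu)
  · rcases key cᶜ (mtClosed_iff_mtOpen_compl.1 hc) with hcu | huc
    · exact compl_le_of_compl_le hcu
    · exact (hne (le_bot_iff.1 (disjoint_compl_right inf_le_right (htu.trans huc)))).elim

end InteriorOperator

/-- Every nontrivial compact `T₀`-algebra contains a closed atom. -/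
theorem compact_t0_has_closed_atom {M : Type*} [CompleteBooleanAlgebra M] (box : M → M)
    (hMT : IsMT box) (hT0 : JoinDense {a : M | MTT0Elem box a})
    (hnt : (⊥ : M) ≠ ⊤) (hcomp : MTCompactElem box ⊤) :
    ∃ x : M, IsAtom x ∧ MTClosed box x := by
  obtain ⟨u, hu⟩ := hcomp.exists_maximal_open hMT hnt
  refine ⟨uᶜ, isAtom_compl_of_maximal_open hMT hT0 hu, mtClosed_iff_mtOpen_compl.2 ?_⟩
  rw [compl_compl]
  exact hu.prop.1
end

section
/- Let M be a T₀-algebra and let p be a saturated element of M that is completely join-prime in the lattice of saturated elements: p ≠ ⊥, and for every set T of saturated elements, if p ≤ ⨅{t saturated : s ≤ t for all s ∈ T} then p ≤ s for some s ∈ T. Then there is an atom x of M with p = 𝗌x, where 𝗌x = ⨅{u open : x ≤ u} is the saturation of x. -/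
/-- The saturation `𝗌x = ⨅ {u open : x ≤ u}` of an element. -/
def MTSat {M : Type*} [CompleteBooleanAlgebra M] (box : M → M) (x : M) : M :=
  sInf {u : M | MTOpen box u ∧ x ≤ u}

/-- Open elements are saturated. -/
theorem MTOpen.mtSaturated {M : Type*} [CompleteBooleanAlgebra M] {box : M → M} {u : M}
    (hu : MTOpen box u) : MTSaturated box u :=
  ⟨{u}, by simpa using hu, by simp⟩

/-- The complement of a closed element is open. -/
theorem MTClosed.mtOpen_compl {M : Type*} [CompleteBooleanAlgebra M] {box : M → M} {c : M}
    (hc : MTClosed box c) : MTOpen box cᶜ :=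
  compl_injective (by rw [compl_compl]; exact hc)

/-- For a completely join-prime saturated `p` there is an open `m` not above `p` that
contains every saturated element not above `p`. -/
theorem exists_mtOpen_greatest_not_ge {M : Type*} [CompleteBooleanAlgebra M] {box : M → M} {p : M}
    (hcjp : ∀ T : Set M, (∀ s ∈ T, MTSaturated box s) →
      p ≤ sInf {t : M | MTSaturated box t ∧ ∀ s ∈ T, s ≤ t} → ∃ s ∈ T, p ≤ s) :
    ∃ m : M, MTOpen box m ∧ ¬ p ≤ m ∧ ∀ s, MTSaturated box s → ¬ p ≤ s → s ≤ m := by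
  have hnot : ¬ p ≤ sInf {t : M | MTSaturated box t ∧
      ∀ s ∈ {s | MTSaturated box s ∧ ¬ p ≤ s}, s ≤ t} := fun h => by
    obtain ⟨s, hs, hps⟩ := hcjp {s | MTSaturated box s ∧ ¬ p ≤ s} (fun s hs => hs.1) h
    exact hs.2 hps
  rw [le_sInf_iff] at hnot
  push Not at hnot
  obtain ⟨t, ⟨⟨U, hU, rfl⟩, ht⟩, hpt⟩ := hnot
  rw [le_sInf_iff] at hpt
  push Not at hpt
  obtain ⟨u, huU, hpu⟩ := hpt
  exact ⟨u, hU u huU, hpu, fun s hs hps => (ht s ⟨hs, hps⟩).trans (sInf_le huU)⟩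

theorem eq_bot_of_le_of_le_compl {M : Type*} [BooleanAlgebra M] {a b : M}
    (h : a ≤ b) (h' : a ≤ bᶜ) : a = ⊥ :=
  le_bot_iff.1 (disjoint_compl_right h h')

/-- In a `T₀`-algebra, every completely join-prime element of the lattice of
saturated elements is the saturation of an atom. -/
theorem cjp_is_saturation_of_atom {M : Type*} [CompleteBooleanAlgebra M] (box : M → M)
    (hMT : IsMT box) (hT0 : JoinDense {a : M | MTT0Elem box a})
    (p : M) (hp : MTSaturated box p) (hpne : p ≠ ⊥)
    (hcjp : ∀ T : Set M, (∀ s ∈ T, MTSaturated box s) →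
      p ≤ sInf {t : M | MTSaturated box t ∧ ∀ s ∈ T, s ≤ t} → ∃ s ∈ T, p ≤ s) :
    ∃ x : M, IsAtom x ∧ p = MTSat box x := by
  obtain ⟨m, -, hpm, hmax⟩ := exists_mtOpen_greatest_not_ge hcjp
  have hx : p ⊓ mᶜ ≠ ⊥ := fun h => hpm (by rwa [← sdiff_eq, sdiff_eq_bot_iff] at h)
  refine ⟨p ⊓ mᶜ, ⟨hx, fun y hy => ?_⟩, le_antisymm ?_ ?_⟩
  · by_contra hy0
    obtain ⟨T, hT, rfl⟩ := hT0 y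
    obtain ⟨a, haT, ha0⟩ : ∃ a ∈ T, a ≠ ⊥ := by
      by_contra! h
      exact hy0 (sSup_eq_bot.2 h)
    obtain ⟨s, c, hs, hc, rfl⟩ := hT haT
    have hax : s ⊓ c ≤ p ⊓ mᶜ := (le_sSup haT).trans hy.le
    have hps : p ≤ s := by
      by_contra h
      exact ha0 (eq_bot_of_le_of_le_compl
        (inf_le_left.trans (hmax s hs h)) (hax.trans inf_le_right))
    have hpc : cᶜ ≤ m := by
      refine hmax _ hc.mtOpen_compl.mtSaturated fun h => ha0 ?_
      exact eq_bot_of_le_of_le_compl inf_le_right ((hax.trans inf_le_left).trans h)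
    exact hy.not_ge ((inf_le_inf hps (compl_le_iff_compl_le.1 hpc)).trans (le_sSup haT))
  · refine le_sInf fun u ⟨hu, hxu⟩ => ?_
    by_contra h
    exact hx (eq_bot_of_le_of_le_compl
      (hxu.trans (hmax u hu.mtSaturated h)) inf_le_right)
  · obtain ⟨U, hU, rfl⟩ := hp
    exact le_sInf fun u hu => sInf_le ⟨hU u hu, inf_le_left.trans (sInf_le hu)⟩
end

section
/- Every completely prime filter of a frame is strongly exact: if L is a frame, P is a completely prime filter of L, and S ⊆ P is a set whose meet is strongly exact (i.e., for all a ∈ L, if s ⇨ a = a for every s ∈ S, then (⨅S) ⇨ a = a), then ⨅S ∈ P. -/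
/-- Every completely prime filter of a frame is strongly exact: it is closed
under strongly exact meets. -/
theorem completely_prime_filter_strongly_exact {L : Type*} [Order.Frame L]
    (P : Set L) (hP : FrameFilter P)
    (hcp : ∀ S : Set L, sSup S ∈ P → ∃ s ∈ S, s ∈ P)
    (S : Set L) (hSP : S ⊆ P)
    (hse : ∀ a : L, (∀ s ∈ S, s ⇨ a = a) → sInf S ⇨ a = a) :
    sInf S ∈ P := by
  obtain ⟨⟨x, hx⟩, hup, hinf⟩ := hP
  have hp : sSup Pᶜ ∉ P := fun h => by
    obtain ⟨s, hs, hsP⟩ := hcp _ h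
    exact hs hsP
  have himp : sInf S ⇨ sSup Pᶜ = sSup Pᶜ := by
    refine hse _ fun s hs => le_antisymm (le_sSup fun h => hp ?_) le_himp
    exact hup _ _ (hinf _ _ (hSP hs) h) inf_himp_le
  by_contra hS
  rw [himp_eq_top_iff.mpr (le_sSup hS)] at himp
  exact hp (himp ▸ hup x ⊤ hx le_top)
end

section
/- Let X be a sober topological space in which every singleton {x} is nowhere dense (the interior of the closure of {x} is empty). Then no completely prime filter of the frame of open sets of X contains all dense open sets of X. -/
open TopologicalSpace

/-- If `X` is a sober space in which every singleton is nowhere dense, then no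
completely prime filter of the frame of open sets contains all dense open sets. -/
theorem no_cp_filter_contains_all_dense_opens {X : Type*} [TopologicalSpace X]
    [T0Space X] [QuasiSober X]
    (hnd : ∀ x : X, interior (closure {x}) = (∅ : Set X)) :
    ¬ ∃ P : Set (Opens X),
      P.Nonempty ∧
      (∀ U V : Opens X, U ∈ P → U ≤ V → V ∈ P) ∧
      (∀ U V : Opens X, U ∈ P → V ∈ P → U ⊓ V ∈ P) ∧
      (∀ S : Set (Opens X), sSup S ∈ P → ∃ U ∈ S, U ∈ P) ∧
      (∀ U : Opens X, Dense (U : Set X) → U ∈ P) := by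
  rintro ⟨P, ⟨A, hA⟩, hup, hinf, hcp, hdense⟩
  -- The complement of the largest open set outside `P` is irreducible and closed.
  set W : Opens X := sSup Pᶜ
  have hWP : W ∉ P := fun h => by
    obtain ⟨U, hU, hUP⟩ := hcp _ h
    exact hU hUP
  have mem_of_meets : ∀ U : Opens X, ((W : Set X)ᶜ ∩ U).Nonempty → U ∈ P := by
    rintro U ⟨x, hxW, hxU⟩
    by_contra hU
    exact hxW ((le_sSup hU : U ≤ W) hxU)
  have meets_of_mem : ∀ U : Opens X, U ∈ P → ((W : Set X)ᶜ ∩ U).Nonempty := by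
    intro U hU
    by_contra hne
    refine hWP (hup U W hU fun x hx => ?_)
    by_contra hxW
    exact hne ⟨x, hxW, hx⟩
  have hirr : IsIrreducible (W : Set X)ᶜ := by
    refine ⟨(meets_of_mem A hA).mono Set.inter_subset_left, fun U V hU hV hCU hCV => ?_⟩
    exact meets_of_mem (⟨U, hU⟩ ⊓ ⟨V, hV⟩)
      (hinf _ _ (mem_of_meets ⟨U, hU⟩ hCU) (mem_of_meets ⟨V, hV⟩ hCV))
  obtain ⟨x, hx⟩ := QuasiSober.sober hirr W.isOpen.isClosed_compl
  refine hWP (hdense W ?_)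
  rw [← compl_compl (W : Set X), ← interior_eq_empty_iff_dense_compl, ← hx.def]
  exact hnd x
end
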